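/- Let d ≥ 1 be an integer, let θ̂, θ* ∈ ℝ^d, and let μ* > 0 and ε > 0 be real numbers. Assume ‖θ*‖₁ = 1, ‖θ̂ − μ*·θ*‖₁ ≤ ε, and ε ≤ μ*/2. Then θ̂ ≠ 0 and the ℓ1-normalized vector θ̂₀ := θ̂/‖θ̂‖₁ satisfies ‖θ̂₀ − θ*‖₁ ≤ 4ε/μ*. -/

import Mathlib

open Finset

/-- **Normalized Stein Estimation Error (deterministic core).**
If `‖θ*‖₁ = 1`, `‖θ̂ − μ*·θ*‖₁ ≤ ε` with `0 < ε ≤ μ*/2` and `μ* > 0`, then `θ̂ ≠ 0`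
and the ℓ1-normalized vector `θ̂₀ = θ̂ / ‖θ̂‖₁` satisfies `‖θ̂₀ − θ*‖₁ ≤ 4ε/μ*`. -/
theorem stmt_0 (d : ℕ) (hd : 1 ≤ d) (θhat θstar : Fin d → ℝ) (μstar ε : ℝ)
    (hμ : 0 < μstar) (hε : 0 < ε)
    (hunit : ∑ i, |θstar i| = 1)
    (hest : ∑ i, |θhat i - μstar * θstar i| ≤ ε)
    (hεμ : ε ≤ μstar / 2) :
    θhat ≠ 0 ∧
      ∑ i, |θhat i / (∑ k, |θhat k|) - θstar i| ≤ 4 * ε / μstar := by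
  have hscaled : ∑ i, |μstar * θstar i| = μstar := by
    simp_rw [abs_mul, abs_of_pos hμ]
    rw [← Finset.mul_sum, hunit, mul_one]
  have hupper : ∑ i, |θhat i| ≤ ε + μstar := by
    calc ∑ i, |θhat i|
        ≤ ∑ i, (|θhat i - μstar * θstar i| + |μstar * θstar i|) :=
          Finset.sum_le_sum fun i _ => by
            simpa using abs_add_le (θhat i - μstar * θstar i) (μstar * θstar i)
      _ ≤ ε + μstar := by rw [Finset.sum_add_distrib, hscaled]; linarith
  have hlower : μstar ≤ ε + ∑ i, |θhat i| := by
    calc μstar = ∑ i, |μstar * θstar i| := hscaled.symm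
      _ ≤ ∑ i, (|θhat i - μstar * θstar i| + |θhat i|) :=
          Finset.sum_le_sum fun i _ => by
            have h := abs_sub_abs_le_abs_sub (μstar * θstar i) (θhat i)
            rw [abs_sub_comm] at h
            linarith
      _ ≤ ε + ∑ i, |θhat i| := by rw [Finset.sum_add_distrib]; linarith
  constructor
  · rintro rfl
    simp only [Pi.zero_apply, abs_zero, Finset.sum_const_zero] at hlower
    linarith
  generalize (∑ k, |θhat k|) = N at hupper hlower ⊢
  have hN : 0 < N := by linarith
  have hdiff : |μstar - N| ≤ ε := abs_le.mpr ⟨by linarith, by linarith⟩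
  have hsum : ∑ i, |θhat i - N * θstar i| ≤ 2 * ε := by
    calc ∑ i, |θhat i - N * θstar i|
        ≤ ∑ i, (|θhat i - μstar * θstar i| + |μstar - N| * |θstar i|) :=
          Finset.sum_le_sum fun i _ => by
            rw [← abs_mul]
            refine le_of_eq_of_le ?_ (abs_add_le _ _)
            congr 1
            ring
      _ ≤ 2 * ε := by
          rw [Finset.sum_add_distrib, ← Finset.mul_sum, hunit]
          linarith
  have hnormalize : ∀ i, |θhat i / N - θstar i| = |θhat i - N * θstar i| / N := fun i => by
    rw [← abs_of_pos hN, ← abs_div, abs_of_pos hN, sub_div, mul_div_cancel_left₀ _ hN.ne']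
  simp_rw [hnormalize]
  rw [← Finset.sum_div, div_le_div_iff₀ hN hμ]
  nlinarith
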